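/- arXiv:2112.14353 — 2 statements merged into one kernel-verified Lean document; each statement's English description precedes it below -/
import Mathlib

section
/- Let Y = θ₀ + Z ∈ ℝⁿ (Z any vector, y = θ₀ + z deterministic identity), σ > 0, and for each s ∈ S define R(s) = ‖(I − H_s)θ₀‖₂² + σ²‖H_s‖_F², W_s = (1/σ²) zᵀ(2H_s − H_sᵀH_s) z + tr(H_sᵀH_s) − 2 tr(H_s), and Z_s = (1/σ²) θ₀ᵀ(H_s − I)ᵀ(I − H_s) z. If ŝ ∈ S satisfies ‖y − H_{ŝ} y‖₂² + 2σ² tr(H_{ŝ}) ≤ ‖y − H_{s₀} y‖₂² + 2σ² tr(H_{s₀}), then (1/σ²)(R(ŝ) − R(s₀)) ≤ W_{ŝ} − W_{s₀} + 2(Z_{ŝ} − Z_{s₀}). -/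
open Matrix

/-- Expansion of the residual sum of squares of a linear smoother applied to `θ + z`. -/
lemma sum_sq_residual_add {ι : Type*} [Fintype ι] [DecidableEq ι]
    (A : Matrix ι ι ℝ) (θ z : ι → ℝ) :
    ∑ i, ((θ + z) i - (A *ᵥ (θ + z)) i) ^ 2 =
      ∑ i, (θ i - (A *ᵥ θ) i) ^ 2 + z ⬝ᵥ z - z ⬝ᵥ ((2 • A - Aᵀ * A) *ᵥ z)
        - 2 * (θ ⬝ᵥ (((A - 1)ᵀ * (1 - A)) *ᵥ z)) := by
  have hquad : z ⬝ᵥ ((2 • A - Aᵀ * A) *ᵥ z) =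
      2 * (z ⬝ᵥ (A *ᵥ z)) - (A *ᵥ z) ⬝ᵥ (A *ᵥ z) := by
    rw [sub_mulVec, dotProduct_sub, ← mulVec_mulVec, dotProduct_mulVec z Aᵀ, vecMul_transpose,
      smul_mulVec, dotProduct_smul, nsmul_eq_mul, Nat.cast_ofNat]
  have hcross : θ ⬝ᵥ (((A - 1)ᵀ * (1 - A)) *ᵥ z) = (A *ᵥ θ - θ) ⬝ᵥ (z - A *ᵥ z) := by
    rw [← mulVec_mulVec, dotProduct_mulVec, vecMul_transpose, sub_mulVec, sub_mulVec,
      one_mulVec, one_mulVec]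
  rw [hquad, hcross, mulVec_add]
  simp only [dotProduct, Finset.mul_sum, ← Finset.sum_add_distrib, ← Finset.sum_sub_distrib,
    Pi.add_apply, Pi.sub_apply]
  exact Finset.sum_congr rfl fun i _ => by ring

/-- deterministic basic inequality: with `y = θ₀ + z`,
`R(s) = ‖(I − H_s)θ₀‖² + σ²‖H_s‖_F²`,
`W_s = (1/σ²) zᵀ(2H_s − H_sᵀH_s)z + tr(H_sᵀH_s) − 2 tr(H_s)` and
`Z_s = (1/σ²) θ₀ᵀ(H_s − I)ᵀ(I − H_s) z`, if `sh` has SURE value no larger than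
`s₀`, then `(1/σ²)(R(sh) − R(s₀)) ≤ W_{sh} − W_{s₀} + 2(Z_{sh} − Z_{s₀})`. -/
theorem basic_inequality
    (n : ℕ) (σ : ℝ) (hσ : 0 < σ) (θ₀ z : Fin n → ℝ) (y : Fin n → ℝ)
    (hy : y = θ₀ + z)
    {S : Type} (H : S → Matrix (Fin n) (Fin n) ℝ)
    (R : S → ℝ)
    (hR : ∀ s, R s = (∑ i, (θ₀ i - (H s).mulVec θ₀ i) ^ 2)
      + σ ^ 2 * ((H s)ᵀ * H s).trace)
    (W : S → ℝ)
    (hW : ∀ s, W s = (1 / σ ^ 2) * (z ⬝ᵥ (2 • H s - (H s)ᵀ * H s).mulVec z)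
      + ((H s)ᵀ * H s).trace - 2 * (H s).trace)
    (Zs : S → ℝ)
    (hZ : ∀ s, Zs s = (1 / σ ^ 2) *
      (θ₀ ⬝ᵥ ((H s - 1)ᵀ * (1 - H s)).mulVec z))
    (sh s₀ : S)
    (hsure : (∑ i, (y i - (H sh).mulVec y i) ^ 2) + 2 * σ ^ 2 * (H sh).trace
      ≤ (∑ i, (y i - (H s₀).mulVec y i) ^ 2) + 2 * σ ^ 2 * (H s₀).trace) :
    (1 / σ ^ 2) * (R sh - R s₀) ≤ W sh - W s₀ + 2 * (Zs sh - Zs s₀) := by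
  subst hy
  rw [sum_sq_residual_add, sum_sq_residual_add] at hsure
  rw [hR, hR, hW, hW, hZ, hZ, one_div, inv_mul_le_iff₀ (by positivity)]
  have hσ' : σ ^ 2 * (σ ^ 2)⁻¹ = 1 := mul_inv_cancel₀ (by positivity)
  simp only [@mul_add ℝ, @mul_sub ℝ, mul_left_comm (σ ^ 2) 2, ← mul_assoc (σ ^ 2) (σ ^ 2)⁻¹,
    mul_left_comm 2 (σ ^ 2)⁻¹, hσ', one_mul]
  linarith
end

section
/- Fix n ≥ 1 and k with 1 ≤ k ≤ n, and for each i ∈ {1,…,n} let N_k(i) ⊆ {1,…,n} be a set with |N_k(i)| ≤ k (the k nearest neighbors of point i). Define the k-nearest-neighbor smoother matrix H_k ∈ ℝ^{n×n} by (H_k)_{ij} = (1/k)·1{j ∈ N_k(i)}, and let N_k^{-1}(i) = {j : i ∈ N_k(j)}. Then ‖H_k‖_op² ≤ (1/k) max_{i≤n} |N_k^{-1}(i)|. -/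
/-- The ℓ²→ℓ² operator (spectral) norm of a real square matrix. -/
noncomputable def opNorm {n : ℕ} (A : Matrix (Fin n) (Fin n) ℝ) : ℝ :=
  ‖Matrix.toEuclideanCLM (𝕜 := ℝ) A‖

/-- Schur test: a nonnegative matrix with row sums at most `r` and column sums at most `c` has
squared spectral norm at most `r * c`. -/
theorem Matrix.sq_norm_toEuclideanCLM_le_of_sum_le {ι : Type*} [Fintype ι] [DecidableEq ι]
    {A : Matrix ι ι ℝ} {r c : ℝ} (hA : ∀ i j, 0 ≤ A i j) (hr : 0 ≤ r) (hc : 0 ≤ c)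
    (hrow : ∀ i, ∑ j, A i j ≤ r) (hcol : ∀ j, ∑ i, A i j ≤ c) :
    ‖Matrix.toEuclideanCLM (𝕜 := ℝ) A‖ ^ 2 ≤ r * c := by
  rw [← Real.le_sqrt (norm_nonneg _) (mul_nonneg hr hc)]
  refine ContinuousLinearMap.opNorm_le_bound _ (Real.sqrt_nonneg _) fun x => ?_
  refine le_of_sq_le_sq ?_ (by positivity)
  rw [mul_pow, Real.sq_sqrt (mul_nonneg hr hc), EuclideanSpace.real_norm_sq_eq,
    EuclideanSpace.real_norm_sq_eq]
  calc ∑ i, (A.mulVec x.ofLp i) ^ 2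
      ≤ ∑ i, r * ∑ j, A i j * x j ^ 2 := by
        refine Finset.sum_le_sum fun i _ => ?_
        refine (Finset.sum_sq_le_sum_mul_sum_of_sq_le_mul Finset.univ (fun j _ => hA i j)
          (fun j _ => mul_nonneg (hA i j) (sq_nonneg (x j))) 
          fun j _ => le_of_eq (by ring)).trans ?_
        exact mul_le_mul_of_nonneg_right (hrow i)
          (Finset.sum_nonneg fun j _ => mul_nonneg (hA i j) (sq_nonneg _))
    _ = r * ∑ j, (∑ i, A i j) * x j ^ 2 := by
        rw [← Finset.mul_sum, Finset.sum_comm]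
        simp only [Finset.sum_mul]
    _ ≤ r * ∑ j, c * x j ^ 2 := by
        gcongr with j
        exact hcol j
    _ = r * c * ∑ j, x j ^ 2 := by rw [← Finset.mul_sum, mul_assoc]

/-- For the k-nearest-neighbor smoother matrix
`(H_k)_{ij} = (1/k)·1{j ∈ N_k(i)}` with `|N_k(i)| ≤ k`, the squared operator
norm is at most `(1/k) max_i |N_k^{-1}(i)|` where `N_k^{-1}(i) = {j : i ∈ N_k(j)}`. -/
theorem knn_opNorm_sq_le (n k : ℕ) (hn : 1 ≤ n) (hk1 : 1 ≤ k) (hkn : k ≤ n)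
    (N : Fin n → Finset (Fin n)) (hcard : ∀ i, (N i).card ≤ k) :
    opNorm (Matrix.of fun i j : Fin n => (1 / (k : ℝ)) * (if j ∈ N i then 1 else 0)) ^ 2
      ≤ (1 / (k : ℝ)) *
        ⨆ i : Fin n, ((Finset.univ.filter fun j : Fin n => i ∈ N j).card : ℝ) := by
  have hk : (0 : ℝ) < k := by exact_mod_cast hk1
  rw [← one_mul (1 / (k : ℝ) * ⨆ i : Fin n, _)]
  refine Matrix.sq_norm_toEuclideanCLM_le_of_sum_le (fun i j => ?_) zero_le_one
    (mul_nonneg (by positivity) (Real.iSup_nonneg fun i => Nat.cast_nonneg _))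
    (fun i => ?_) (fun j => ?_)
  · rw [Matrix.of_apply]
    positivity
  · simp only [Matrix.of_apply, ← Finset.mul_sum, Finset.sum_boole, Finset.filter_univ_mem]
    rw [one_div_mul_eq_div, div_le_one hk]
    exact_mod_cast hcard i
  · simp only [Matrix.of_apply, ← Finset.mul_sum, Finset.sum_boole]
    gcongr
    exact le_ciSup (f := fun i : Fin n => ((Finset.univ.filter fun j => i ∈ N j).card : ℝ))
      (Set.finite_range _).bddAbove j
end
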